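/- arXiv:1605.04626 — 8 statements merged into one kernel-verified Lean document; each statement's English description precedes it below -/
import Mathlib

section
/- For every positive integer N, every integer K ≥ 2, and every cache size M ∈ (0, N], the rate of the decentralized coded caching scheme is at least that of the centralized coded caching scheme: R_C(M) ≤ R_D(M). -/
/-- Centralized coded caching rate `R_C(M)` for `N` files and `K` users:
linear interpolation of `K·(1 − s/K)·min{1/(1+s), N/K}` between the grid
points `M = sN/K`, with `s = ⌈KM/N⌉` and `θ = s − KM/N`. -/
noncomputable def Rc (N K : ℕ) (M : ℝ) : ℝ :=
  let s : ℤ := ⌈(K : ℝ) * M / N⌉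
  let θ : ℝ := (s : ℝ) - (K : ℝ) * M / N
  θ * ((K : ℝ) * (1 - ((s : ℝ) - 1) / K) * min (1 / (1 + ((s : ℝ) - 1))) ((N : ℝ) / K))
    + (1 - θ) * ((K : ℝ) * (1 - (s : ℝ) / K) * min (1 / (1 + (s : ℝ))) ((N : ℝ) / K))

/-- Decentralized coded caching rate `R_D(M)` for `N` files and `K` users. -/
noncomputable def Rd (N K : ℕ) (M : ℝ) : ℝ :=
  (K : ℝ) * (1 - M / N) * min ((N : ℝ) / ((K : ℝ) * M) * (1 - (1 - M / N) ^ K)) ((N : ℝ) / K)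

/-- A degree-two Bonferroni (Dawson–Sankoff) bound for the binomial distribution:
the probability of at least one success in `n` independent trials. -/
theorem binomial_dawson_sankoff (n : ℕ) (s : ℤ) (hs : 1 ≤ s) (q : ℝ) (hq0 : 0 ≤ q) (hq1 : q ≤ 1) :
    2 * s * (n * q) - n * (n - 1) * q ^ 2 ≤ s * (s + 1) * (1 - (1 - q) ^ n) := by
  let P : ℕ → ℝ := fun y => (bernsteinPolynomial ℝ n y).eval q
  have hP (y : ℕ) : P y = n.choose y * q ^ y * (1 - q) ^ (n - y) := by
    simp [P, bernsteinPolynomial]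
  have hP0 (y : ℕ) : 0 ≤ P y := by
    rw [hP]
    have : 0 ≤ 1 - q := by linarith
    positivity
  have h0 : ∑ y ∈ Finset.range (n + 1), P y = 1 := by
    have := congrArg (Polynomial.eval q) (bernsteinPolynomial.sum ℝ n)
    simpa [Polynomial.eval_finsetSum, P] using this
  have h1 : ∑ y ∈ Finset.range (n + 1), (y : ℝ) * P y = n * q := by
    have := congrArg (Polynomial.eval q) (bernsteinPolynomial.sum_smul ℝ n)
    simpa [Polynomial.eval_finsetSum, P] using this
  have h2 : ∑ y ∈ Finset.range (n + 1), ((y * (y - 1) : ℕ) : ℝ) * P y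
      = ((n * (n - 1) : ℕ) : ℝ) * q ^ 2 := by
    have := congrArg (Polynomial.eval q) (bernsteinPolynomial.sum_mul_smul ℝ n)
    simpa [Polynomial.eval_finsetSum, P] using this
  have cast_pred (m : ℕ) : ((m * (m - 1) : ℕ) : ℝ) = m * (m - 1) := by
    cases m <;> simp
  simp only [cast_pred] at h2
  have hs' : (1 : ℝ) ≤ s := by exact_mod_cast hs
  have key (y : ℕ) : 2 * s * (y * P y) - y * (y - 1) * P y
      ≤ s * (s + 1) * (P y - if y = 0 then P 0 else 0) := by
    rcases eq_or_ne y 0 with rfl | hy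
    · simp
    · have hz : (0 : ℤ) ≤ (y - s) * (y - s - 1) := by
        rcases le_or_gt (y : ℤ) s with h | h
        · exact mul_nonneg_of_nonpos_of_nonpos (by omega) (by omega)
        · exact mul_nonneg (by omega) (by omega)
      have hz' : (0 : ℝ) ≤ (y - s) * (y - s - 1) := by exact_mod_cast hz
      rw [if_neg hy]
      nlinarith [mul_nonneg hz' (hP0 y)]
  have hsum := Finset.sum_le_sum fun y (_ : y ∈ Finset.range (n + 1)) => key y
  rw [Finset.sum_sub_distrib, ← Finset.mul_sum, ← Finset.mul_sum, Finset.sum_sub_distrib,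
    h0, h1, h2, Finset.sum_ite_eq' (Finset.range (n + 1)) 0 fun _ => P 0] at hsum
  simpa [hP] using hsum

/-- The centralized rate never exceeds the decentralized rate. -/
theorem centralized_le_decentralized (N K : ℕ) (hN : 0 < N) (hK : 2 ≤ K)
    (M : ℝ) (hM0 : 0 < M) (hMN : M ≤ N) :
    Rc N K M ≤ Rd N K M := by
  have hN' : (0 : ℝ) < N := by exact_mod_cast hN
  have hK' : (0 : ℝ) < K := by exact_mod_cast (by omega : 0 < K)
  obtain ⟨q, rfl⟩ : ∃ q, M = q * N := ⟨M / N, by field_simp⟩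
  have hq0 : 0 < q := pos_of_mul_pos_left hM0 hN'.le
  have hq1 : q ≤ 1 := by nlinarith
  have hMq : q * N / N = q := by field_simp
  have hKq : (K : ℝ) * (q * N) / N = K * q := by field_simp
  have hNKM : (N : ℝ) / (K * (q * N)) = 1 / (K * q) := by field_simp
  simp only [Rc, Rd, hMq, hKq, hNKM]
  have hs1 : 1 ≤ ⌈(K : ℝ) * q⌉ := Int.one_le_ceil_iff.2 (by positivity)
  have hsK : ⌈(K : ℝ) * q⌉ ≤ K := Int.ceil_le.2 (by push_cast; nlinarith)
  have hle : (K : ℝ) * q ≤ ⌈(K : ℝ) * q⌉ := Int.le_ceil _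
  have hlt : (⌈(K : ℝ) * q⌉ : ℝ) < K * q + 1 := Int.ceil_lt_add_one _
  have hDS := binomial_dawson_sankoff (K + 1) _ hs1 q hq0.le hq1
  generalize ⌈(K : ℝ) * q⌉ = z at *
  have hs1' : (1 : ℝ) ≤ z := by exact_mod_cast hs1
  have hsK' : (z : ℝ) ≤ K := by exact_mod_cast hsK
  generalize (z : ℝ) = s at *
  have ha : 0 ≤ (K : ℝ) * (1 - (s - 1) / K) := by
    rw [mul_sub, mul_div_cancel₀ _ hK'.ne']; linarith
  have hb : 0 ≤ (K : ℝ) * (1 - s / K) := by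
    rw [mul_sub, mul_div_cancel₀ _ hK'.ne']; linarith
  have hθ0 : 0 ≤ s - K * q := by linarith
  have hθ1 : 0 ≤ 1 - (s - K * q) := by linarith
  rw [mul_min_of_nonneg _ _ (mul_nonneg hK'.le (sub_nonneg.2 hq1))]
  refine le_min ?_ ?_
  · calc
      _ ≤ (s - K * q) * (K * (1 - (s - 1) / K) * (1 / (1 + (s - 1))))
          + (1 - (s - K * q)) * (K * (1 - s / K) * (1 / (1 + s))) := by
        gcongr <;> exact min_le_left _ _
      _ = (K + 1) * (2 * s - K * q) / (s * (s + 1)) - 1 := by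
        have : 1 + s ≠ 0 := by linarith
        have : s ≠ 0 := by linarith
        rw [add_sub_cancel, add_comm s 1]
        field_simp
        ring
      _ ≤ (1 - (1 - q) ^ (K + 1)) / q - 1 := by
        gcongr ?_ - 1
        rw [div_le_div_iff₀ (by positivity) hq0]
        push_cast at hDS
        linarith
      _ = _ := by
        field_simp
        ring
  · calc
      _ ≤ (s - K * q) * (K * (1 - (s - 1) / K) * (N / K))
          + (1 - (s - K * q)) * (K * (1 - s / K) * (N / K)) := by
        gcongr <;> exact min_le_right _ _
      _ = _ := by
        field_simp
        ring
end

section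
/- For every positive integer N, every integer K ≥ 2, and every cache size M ∈ (0, N], the rate of the decentralized coded caching scheme is at most 1.5 times that of the centralized coded caching scheme: R_D(M) ≤ (3/2)·R_C(M). -/
theorem one_fourth_le_one_sub_inv_pow {K : ℕ} (hK : 2 ≤ K) :
    (1 / 4 : ℝ) ≤ (1 - 1 / (K : ℝ)) ^ K := by
  have hK' : (2 : ℝ) ≤ K := by exact_mod_cast hK
  have hK0 : (0 : ℝ) < K := by linarith
  have hinv : 1 / (K : ℝ) ≤ 1 := by
    rw [div_le_one hK0]
    linarith
  have hbern := one_add_mul_self_le_rpow_one_add (s := -(1 / (K : ℝ))) (by linarith)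
    (p := (K : ℝ) / 2) (by linarith)
  have hhalf : 1 + (K : ℝ) / 2 * -(1 / (K : ℝ)) = 1 / 2 := by
    field_simp
    norm_num
  rw [hhalf, ← sub_eq_add_neg] at hbern
  have hsq : ((1 - 1 / (K : ℝ)) ^ ((K : ℝ) / 2)) ^ 2 = (1 - 1 / (K : ℝ)) ^ K := by
    rw [← Real.rpow_natCast, ← Real.rpow_mul (by linarith), ← Real.rpow_natCast]
    congr 1
    push_cast
    ring
  rw [← hsq]
  nlinarith

theorem convexOn_sum_pow_succ (K : ℕ) :
    ConvexOn ℝ (Set.Ici (0 : ℝ)) fun y => ∑ j ∈ Finset.range K, y ^ (j + 1) := by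
  induction K with
  | zero => simpa using convexOn_const (0 : ℝ) (convex_Ici (0 : ℝ))
  | succ K ih =>
    simp only [Finset.sum_range_succ]
    exact ih.add (convexOn_pow (K + 1))

theorem sum_pow_succ_mul_one_sub (K : ℕ) (y : ℝ) :
    (∑ j ∈ Finset.range K, y ^ (j + 1)) * (1 - y) = y * (1 - y ^ K) := by
  simp only [pow_succ']
  rw [← Finset.mul_sum, mul_assoc, geom_sum_mul_neg]

/-- At the grid points, the decentralized rate (with more files than users) is at most
`3 / 2` times the centralized one. -/
theorem sum_pow_succ_le_at_grid {K : ℕ} (hK : 2 ≤ K) {n : ℕ} (hn : n ≤ K) :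
    ∑ j ∈ Finset.range K, (1 - (n : ℝ) / K) ^ (j + 1) ≤
      3 / 2 * (((K : ℝ) - n) * (1 / (1 + (n : ℝ)))) := by
  have hK' : (2 : ℝ) ≤ K := by exact_mod_cast hK
  have hK0 : (0 : ℝ) < K := by linarith
  have hn' : (n : ℝ) ≤ K := by exact_mod_cast hn
  rcases Nat.eq_zero_or_pos n with rfl | hpos
  · simp
    linarith
  have hn0 : (1 : ℝ) ≤ n := by exact_mod_cast hpos
  have hgeom := sum_pow_succ_mul_one_sub K (1 - (n : ℝ) / K)
  set S := ∑ j ∈ Finset.range K, (1 - (n : ℝ) / K) ^ (j + 1)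
  have hS : S * n = (K - n) * (1 - (1 - (n : ℝ) / K) ^ K) := by
    generalize (1 - (n : ℝ) / K) ^ K = p at hgeom ⊢
    field_simp at hgeom
    linarith
  rcases eq_or_lt_of_le (show 1 ≤ n from hpos) with rfl | h2
  · have := one_fourth_le_one_sub_inv_pow hK
    norm_num at hS this ⊢
    nlinarith
  · have hn2 : (2 : ℝ) ≤ n := by exact_mod_cast h2
    have hq : 0 ≤ 1 - (n : ℝ) / K := by
      rw [sub_nonneg, div_le_one hK0]
      exact hn'
    have hSn : S * n ≤ K - n := by
      rw [hS]
      nlinarith [pow_nonneg hq K]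
    have hS' : S ≤ (K - n) / n := (le_div_iff₀ (by linarith)).2 hSn
    refine hS'.trans ?_
    rw [mul_one_div, ← mul_div_assoc, div_le_div_iff₀ (by linarith) (by linarith)]
    nlinarith

/-- The decentralized rate is at most 1.5 times the centralized rate. -/
theorem decentralized_le_three_halves_centralized (N K : ℕ) (hN : 0 < N) (hK : 2 ≤ K)
    (M : ℝ) (hM0 : 0 < M) (hMN : M ≤ N) :
    Rd N K M ≤ (3 / 2) * Rc N K M := by
  have hN0 : (0 : ℝ) < N := by exact_mod_cast hN
  have hK' : (2 : ℝ) ≤ K := by exact_mod_cast hK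
  have hK0 : (0 : ℝ) < K := by linarith
  unfold Rd Rc
  have ht0 : 0 < (K : ℝ) * M / N := by positivity
  have htK : (K : ℝ) * M / N ≤ K := by
    rw [div_le_iff₀ hN0]
    gcongr
  have hMt : M / N = (K : ℝ) * M / N / K := by field_simp
  have hNt : (N : ℝ) / (K * M) = 1 / ((K : ℝ) * M / N) := by field_simp
  rw [hMt, hNt]
  set t := (K : ℝ) * M / N
  have hc0 : 0 < (N : ℝ) / K := by positivity
  generalize (N : ℝ) / K = c at hc0 ⊢
  obtain ⟨n, hn⟩ : ∃ n : ℕ, ⌈t⌉ = (n : ℤ) + 1 := by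
    have := Int.ceil_pos.2 ht0
    exact ⟨(⌈t⌉ - 1).toNat, by omega⟩
  have hnK : n + 1 ≤ K := by
    have : ⌈t⌉ ≤ (K : ℤ) := Int.ceil_le.2 (by exact_mod_cast htK)
    omega
  have hle : t ≤ (n : ℝ) + 1 := by
    have := Int.le_ceil t
    rw [hn] at this
    exact_mod_cast this
  have hlt : (n : ℝ) < t := by
    have := Int.ceil_lt_add_one t
    rw [hn] at this
    push_cast at this
    linarith
  rw [hn]
  push_cast
  have hnK' : (n : ℝ) + 1 ≤ K := by exact_mod_cast hnK
  have hn0 : (0 : ℝ) ≤ n := n.cast_nonneg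
  have e1 : (K : ℝ) * (1 - ((n : ℝ) + 1 - 1) / K) = K - n := by
    field_simp
    ring
  have e2 : (K : ℝ) * (1 - ((n : ℝ) + 1) / K) = K - (n + 1) := by field_simp
  have e3 : (K : ℝ) * (1 - t / K) = K - t := by field_simp
  rw [e1, e2, e3, add_sub_cancel_right]
  obtain ⟨θ, hθ⟩ : ∃ θ, θ = (n : ℝ) + 1 - t := ⟨_, rfl⟩
  rw [← hθ]
  have hθ0 : 0 ≤ θ := by linarith
  have hθ1 : 0 ≤ 1 - θ := by linarith
  have hA : (0 : ℝ) ≤ K - n := by linarith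
  have hB : (0 : ℝ) ≤ K - (n + 1) := by linarith
  have key : ∀ a b u v : ℝ, a ≤ 3 / 2 * ((K - n) * u) → b ≤ 3 / 2 * ((K - (n + 1)) * v) →
      θ * a + (1 - θ) * b ≤
        3 / 2 * (θ * ((K - n) * u) + (1 - θ) * ((K - (n + 1)) * v)) := by
    intro a b u v ha hb
    linarith [mul_le_mul_of_nonneg_left ha hθ0, mul_le_mul_of_nonneg_left hb hθ1]
  rcases le_or_gt c (3 / 2 * (1 / (1 + ((n : ℝ) + 1)))) with hc | hc
  · have hmono : 1 / (1 + ((n : ℝ) + 1)) ≤ 1 / (1 + (n : ℝ)) := by gcongr; linarith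
    have h1 : c ≤ 3 / 2 * min (1 / (1 + (n : ℝ))) c := by
      rcases min_cases (1 / (1 + (n : ℝ))) c with h | h <;> linarith
    have h2 : c ≤ 3 / 2 * min (1 / (1 + ((n : ℝ) + 1))) c := by
      rcases min_cases (1 / (1 + ((n : ℝ) + 1))) c with h | h <;> linarith
    calc (K - t) * min (1 / t * (1 - (1 - t / K) ^ K)) c ≤ (K - t) * c :=
          mul_le_mul_of_nonneg_left (min_le_right _ _) (by linarith)
      _ = θ * ((K - n) * c) + (1 - θ) * ((K - (n + 1)) * c) := by
          rw [hθ]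
          ring
      _ ≤ _ := key _ _ _ _
          (by linarith [mul_le_mul_of_nonneg_left h1 hA])
          (by linarith [mul_le_mul_of_nonneg_left h2 hB])
  · have hinv0 : 0 < 1 / (1 + ((n : ℝ) + 1)) := by positivity
    have hgrid₀ := sum_pow_succ_le_at_grid hK (n := n) (by omega)
    have hgrid₁ := sum_pow_succ_le_at_grid hK hnK
    push_cast at hgrid₁
    have hq : ∀ x : ℝ, x ≤ K → 0 ≤ 1 - x / K := fun x hx => by
      rw [sub_nonneg, div_le_one hK0]
      exact hx
    have hconv := (convexOn_sum_pow_succ K).2 (hq n (by linarith)) (hq (n + 1) hnK') hθ0 hθ1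
      (by ring)
    have hpt : θ * (1 - (n : ℝ) / K) + (1 - θ) * (1 - ((n : ℝ) + 1) / K) = 1 - t / K := by
      rw [hθ]
      field_simp
      ring
    simp only [smul_eq_mul, hpt] at hconv
    have hrate : (K - t) * (1 / t * (1 - (1 - t / K) ^ K)) =
        ∑ j ∈ Finset.range K, (1 - t / K) ^ (j + 1) := by
      have := sum_pow_succ_mul_one_sub K (1 - t / K)
      generalize (1 - t / K) ^ K = p at this ⊢
      generalize ∑ j ∈ Finset.range K, (1 - t / K) ^ (j + 1) = S at this ⊢
      field_simp at this ⊢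
      linarith
    rw [min_eq_left (show 1 / (1 + ((n : ℝ) + 1)) ≤ c by linarith)]
    calc (K - t) * min (1 / t * (1 - (1 - t / K) ^ K)) c
        ≤ (K - t) * (1 / t * (1 - (1 - t / K) ^ K)) :=
          mul_le_mul_of_nonneg_left (min_le_left _ _) (by linarith)
      _ ≤ _ := hrate.le.trans hconv
      _ ≤ _ := by
        refine key _ _ _ _ ?_ hgrid₁
        rcases Nat.eq_zero_or_pos n with rfl | hpos
        · norm_num at hc ⊢
          rcases min_cases (1 : ℝ) c with h | h <;> nlinarith
        · have hn1 : (1 : ℝ) ≤ n := by exact_mod_cast hpos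
          have : 1 / (1 + (n : ℝ)) ≤ 3 / 2 * (1 / (1 + ((n : ℝ) + 1))) := by
            rw [mul_one_div, div_le_div_iff₀ (by linarith) (by linarith)]
            linarith
          rwa [min_eq_left (by linarith)]
end

section
/- For every q ∈ (0, 1] and every positive integer K, one has r̃_C(q, K) ≤ r_D(q, K). -/
/-- `r_C(q, K) = K(1 − q)/(1 + Kq)`. -/
noncomputable def rC (q : ℝ) (K : ℕ) : ℝ := (K : ℝ) * (1 - q) / (1 + (K : ℝ) * q)

/-- `r_D(q, K) = ((1 − q)/q)·(1 − (1 − q)^K)`. -/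
noncomputable def rD (q : ℝ) (K : ℕ) : ℝ := (1 - q) / q * (1 - (1 - q) ^ K)

/-- `r̃_C(q, K)`: linear interpolation of `r_C(·, K)` between the grid points
`(s−1)/K` and `s/K`, where `s = ⌈Kq⌉` and `θ = s − Kq`. -/
noncomputable def rCt (q : ℝ) (K : ℕ) : ℝ :=
  let s : ℤ := ⌈(K : ℝ) * q⌉
  let θ : ℝ := (s : ℝ) - (K : ℝ) * q
  θ * rC (((s : ℝ) - 1) / K) K + (1 - θ) * rC ((s : ℝ) / K) K

/-- The moment `E[(s - X)(s + 1 - X)]` of a binomial variable `X` with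
parameters `n`, `q` is nonnegative for every integer `s`. -/
lemma binomial_quadratic_moment_nonneg {q : ℝ} (hq0 : 0 ≤ q) (hq1 : q ≤ 1) (n : ℕ) (s : ℤ) :
    0 ≤ (s : ℝ) * (s + 1) - 2 * n * q * s + n * (n - 1) * q ^ 2 := by
  induction n generalizing s with
  | zero =>
    have h : 0 ≤ s * (s + 1) := by
      rcases le_or_gt 0 s with h | h
      · positivity
      · exact mul_nonneg_of_nonpos_of_nonpos h.le (by lia)
    have h' : (0 : ℝ) ≤ s * (s + 1) := by exact_mod_cast h
    simpa using h'
  | succ n ih =>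
    have h1 := mul_nonneg (sub_nonneg.2 hq1) (ih s)
    have h2 := mul_nonneg hq0 (ih (s - 1))
    push_cast at h2 ⊢
    linarith

/-- A Dawson–Sankoff type bound for the binomial distribution: since the integer-valued `X`
satisfies `(s - X)(s + 1 - X) ≥ 0`, the mean of this product dominates
the contribution of `X = 0`. -/
lemma one_sub_pow_mul_le_binomial_quadratic_moment {q : ℝ} (hq0 : 0 ≤ q) (hq1 : q ≤ 1) (n : ℕ)
    (s : ℤ) :
    (1 - q) ^ n * (s * (s + 1)) ≤ s * (s + 1) - 2 * n * q * s + n * (n - 1) * q ^ 2 := by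
  induction n with
  | zero => simp
  | succ n ih =>
    have h1 := mul_le_mul_of_nonneg_left ih (sub_nonneg.2 hq1)
    have h2 := mul_nonneg hq0 (binomial_quadratic_moment_nonneg hq0 hq1 n (s - 1))
    rw [pow_succ]
    push_cast at h2 ⊢
    linarith

lemma rC_div {K : ℕ} (hK : 0 < K) (x : ℝ) : rC (x / K) K = (K - x) / (1 + x) := by
  have hK0 : (K : ℝ) ≠ 0 := by positivity
  rw [rC, mul_sub, mul_one, mul_div_cancel₀ _ hK0]

/-- `r̃_C(q, K) ≤ r_D(q, K)` for all `q ∈ (0, 1]` and positive integers `K`. -/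
theorem rCt_le_rD (q : ℝ) (hq0 : 0 < q) (hq1 : q ≤ 1) (K : ℕ) (hK : 0 < K) :
    rCt q K ≤ rD q K := by
  have hs : 0 < ⌈(K : ℝ) * q⌉ := Int.ceil_pos.2 (by positivity)
  simp only [rCt, rC_div hK, rD]
  generalize ⌈(K : ℝ) * q⌉ = s at hs ⊢
  have hs' : (0 : ℝ) < s := by exact_mod_cast hs
  have key := one_sub_pow_mul_le_binomial_quadratic_moment hq0.le hq1 (K + 1) s
  have hdiff : (1 - q) / q * (1 - (1 - q) ^ K) -
      (((s : ℝ) - K * q) * ((K - (s - 1)) / (1 + (s - 1))) +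
        (1 - (s - K * q)) * ((K - s) / (1 + s))) =
      ((s * (s + 1) - 2 * (K + 1 : ℕ) * q * s + (K + 1 : ℕ) * ((K + 1 : ℕ) - 1) * q ^ 2) -
        (1 - q) ^ (K + 1) * (s * (s + 1))) / (q * (s * (s + 1))) := by
    have h1 : (1 : ℝ) + (s - 1) = s := by ring
    have h2 : (1 : ℝ) + s ≠ 0 := by positivity
    have h3 : (s : ℝ) + 1 ≠ 0 := by positivity
    rw [h1, add_comm (1 : ℝ) (s : ℝ), pow_succ]
    push_cast
    field_simp
    ring
  rw [← sub_nonneg, hdiff]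
  exact div_nonneg (sub_nonneg.2 key) (by positivity)
end

section
/- For all positive integers n and s with s ≤ n and every real θ ∈ [0, 1), one has (n − s)/(n(s+1)) + ((n+1)/(n·s·(s+1)))·θ² − (1 − (s − θ)/n)^(n+1) ≥ 0. -/
/-- The second-order Bonferroni bound for `(1 - u) ^ m`. -/
theorem one_sub_pow_le_quadratic {u : ℝ} (hu0 : 0 ≤ u) (hu1 : u ≤ 1) (m : ℕ) :
    (1 - u) ^ m ≤ 1 - m * u + m * (m - 1) / 2 * u ^ 2 := by
  induction m with
  | zero => simp
  | succ m ih =>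
    have hm : (0 : ℝ) ≤ m * (m - 1) := by
      rcases m with _ | m
      · simp
      · push_cast
        rw [add_sub_cancel_right]
        positivity
    have hcube : 0 ≤ (m : ℝ) * (m - 1) * u ^ 3 := by positivity
    have hstep := mul_le_mul_of_nonneg_right ih (sub_nonneg.2 hu1)
    rw [pow_succ]
    push_cast
    linarith

/-- The truncated exponential series turns an exponential bound into a rational one. -/
theorem one_sub_div_pow_le_inv_quadratic {n : ℕ} {t : ℝ} (ht0 : 0 ≤ t) (htn : t ≤ n) :
    (1 - t / n) ^ n ≤ (1 + t + t ^ 2 / 2)⁻¹ := by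
  refine (Real.one_sub_div_pow_le_exp_neg htn).trans ?_
  rw [Real.exp_neg]
  exact inv_anti₀ (by positivity) (Real.quadratic_le_exp_of_nonneg ht0)

theorem mul_add_one_le_quadratic {s θ : ℝ} (hs : 2 ≤ s) (hθ0 : 0 ≤ θ) (hθ1 : θ ≤ 1) :
    s * (s + 1) ≤ (s + θ ^ 2) * (1 + (s - θ) + (s - θ) ^ 2 / 2) := by
  obtain ⟨j, rfl⟩ : ∃ j, s = 2 + j := ⟨s - 2, by ring⟩
  have hj : 0 ≤ j := by linarith
  obtain ⟨d, rfl⟩ : ∃ d, θ = 1 - d := ⟨1 - θ, by ring⟩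
  have hd : 0 ≤ d := by linarith
  have hd1 : 0 ≤ 1 - d := hθ0
  nlinarith

theorem one_add_mul_mul_add_one_le_quadratic {s θ : ℝ} (hs : 2 ≤ s) (hθ0 : 0 ≤ θ) (hθ1 : θ ≤ 1) :
    (1 + θ) * (s * (s + 1)) ≤
      (s + (s + 2) * θ ^ 2) * (1 + (s - θ) + (s - θ) ^ 2 / 2) := by
  obtain ⟨j, rfl⟩ : ∃ j, s = 2 + j := ⟨s - 2, by ring⟩
  have hj : 0 ≤ j := by linarith
  obtain ⟨d, rfl⟩ : ∃ d, θ = 1 - d := ⟨1 - θ, by ring⟩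
  have hd : 0 ≤ d := by linarith
  have hd1 : 0 ≤ 1 - d := hθ0
  nlinarith [sq_nonneg (j * (1 - d)), pow_nonneg hd 3, mul_nonneg hj (pow_nonneg hd 3)]

/-- The rational inequality to which the case `2 ≤ s < n` reduces. -/
theorem mul_inv_quadratic_le {n s θ : ℝ} (hs : 2 ≤ s) (hsn : s + 1 ≤ n)
    (hθ0 : 0 ≤ θ) (hθ1 : θ ≤ 1) :
    (1 + (s - θ) + (s - θ) ^ 2 / 2)⁻¹ * (1 - (s - θ) / n) ≤
      (n - s) / (n * (s + 1)) + (n + 1) / (n * s * (s + 1)) * θ ^ 2 := by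
  have hs0 : 0 < s := by linarith
  have hn0 : 0 < n := by linarith
  have ht : 0 ≤ s - θ := by linarith
  have hD : 0 < 1 + (s - θ) + (s - θ) ^ 2 / 2 := by positivity
  have hpoly : (n - s + θ) * (s * (s + 1)) ≤
      (s * (n - s) + (n + 1) * θ ^ 2) * (1 + (s - θ) + (s - θ) ^ 2 / 2) := by
    linear_combination one_add_mul_mul_add_one_le_quadratic hs hθ0 hθ1 +
      mul_le_mul_of_nonneg_left (mul_add_one_le_quadratic hs hθ0 hθ1) (sub_nonneg.2 hsn)
  have hl : (1 + (s - θ) + (s - θ) ^ 2 / 2)⁻¹ * (1 - (s - θ) / n) =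
      (n - s + θ) / (n * (1 + (s - θ) + (s - θ) ^ 2 / 2)) := by
    generalize 1 + (s - θ) + (s - θ) ^ 2 / 2 = D at hD ⊢
    field_simp
    ring
  have hr : (n - s) / (n * (s + 1)) + (n + 1) / (n * s * (s + 1)) * θ ^ 2 =
      (s * (n - s) + (n + 1) * θ ^ 2) / (n * (s * (s + 1))) := by
    field_simp
  rw [hl, hr, div_le_div_iff₀ (by positivity) (by positivity)]
  linear_combination n * hpoly

/-- The key inequality `f(θ, n, s) ≥ 0` from the appendix:
for positive integers `s ≤ n` and `θ ∈ [0, 1)`,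
`(n − s)/(n(s+1)) + ((n+1)/(n·s·(s+1)))·θ² − (1 − (s − θ)/n)^(n+1) ≥ 0`. -/
theorem f_nonneg (n s : ℕ) (hs : 1 ≤ s) (hsn : s ≤ n) (θ : ℝ) (hθ0 : 0 ≤ θ) (hθ1 : θ < 1) :
    0 ≤ ((n : ℝ) - s) / (n * (s + 1)) + ((n : ℝ) + 1) / (n * s * (s + 1)) * θ ^ 2
      - (1 - ((s : ℝ) - θ) / n) ^ (n + 1) := by
  have hn : (0 : ℝ) < n := by exact_mod_cast hs.trans hsn
  rw [sub_nonneg]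
  rcases hs.eq_or_lt with rfl | hs2
  · have hn1 : (1 : ℝ) ≤ n := by exact_mod_cast hsn
    have hu1 : (1 - θ) / n ≤ 1 := (div_le_one hn).2 (by linarith)
    have h := one_sub_pow_le_quadratic (div_nonneg (sub_nonneg.2 hθ1.le) hn.le) hu1 (n + 1)
    push_cast at h ⊢
    refine h.trans_eq ?_
    field_simp
    ring
  · rcases hsn.eq_or_lt with rfl | hlt
    · have hs1 : (1 : ℝ) ≤ s := by exact_mod_cast hs
      have hbase : 1 - ((s : ℝ) - θ) / s = θ / s := by
        field_simp
        ring
      have hpow : (θ / (s : ℝ)) ^ (s + 1) ≤ (θ / s) ^ 2 :=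
        pow_le_pow_of_le_one (by positivity) ((div_le_one hn).2 (by linarith)) (by omega)
      rw [hbase]
      refine hpow.trans_eq ?_
      field_simp
      ring
    · have hs2' : (2 : ℝ) ≤ s := by exact_mod_cast hs2
      have hlt' : (s : ℝ) + 1 ≤ n := by exact_mod_cast hlt
      have hbase : 0 ≤ 1 - ((s : ℝ) - θ) / n := sub_nonneg.2 ((div_le_one hn).2 (by linarith))
      rw [pow_succ]
      exact (mul_le_mul_of_nonneg_right
        (one_sub_div_pow_le_inv_quadratic (by linarith) (by linarith)) hbase).trans
        (mul_inv_quadratic_le hs2' hlt' hθ0 hθ1.le)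
end

section
/- For every integer n ≥ 2 and every real θ ∈ [0, 1), one has (n − 1)/(2n) + ((n+1)/(2n))·θ² ≥ ((n − 1 + θ)/n)^(n+1). -/
/-- The second-order Bonferroni bound `(1 - y)^k ≤ 1 - k y + (k choose 2) y²` on `[0, 1]`. -/
theorem one_sub_pow_le_quadratic_s8 (k : ℕ) {y : ℝ} (hy0 : 0 ≤ y) (hy1 : y ≤ 1) :
    (1 - y) ^ k ≤ 1 - k * y + (k * (k - 1) / 2 : ℝ) * y ^ 2 := by
  induction k with
  | zero => simp
  | succ k ih =>
    have hchoose : (0 : ℝ) ≤ k * (k - 1) / 2 := by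
      rw [← Nat.cast_choose_two]
      positivity
    have hcube : 0 ≤ (k * (k - 1) / 2 : ℝ) * y ^ 3 := by positivity
    have hstep := mul_le_mul_of_nonneg_right ih (sub_nonneg.2 hy1)
    rw [pow_succ]
    push_cast
    linarith

/-- The case `s = 1` of the key inequality: for every integer `n ≥ 2` and `θ ∈ [0, 1)`,
`(n − 1)/(2n) + ((n+1)/(2n))·θ² ≥ ((n − 1 + θ)/n)^(n+1)`. -/
theorem f_nonneg_s_eq_one (n : ℕ) (hn : 2 ≤ n) (θ : ℝ) (hθ0 : 0 ≤ θ) (hθ1 : θ < 1) :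
    (((n : ℝ) - 1 + θ) / n) ^ (n + 1)
      ≤ ((n : ℝ) - 1) / (2 * n) + ((n : ℝ) + 1) / (2 * n) * θ ^ 2 := by
  have hn1 : (1 : ℝ) ≤ n := by exact_mod_cast (one_le_two.trans hn)
  have hn0 : (n : ℝ) ≠ 0 := by positivity
  have hy0 : 0 ≤ (1 - θ) / n := div_nonneg (by linarith) (by linarith)
  have hy1 : (1 - θ) / n ≤ 1 := (div_le_one (by linarith)).2 (by linarith)
  convert one_sub_pow_le_quadratic_s8 (n + 1) hy0 hy1 using 1
  · congr 1
    field_simp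
    ring
  · push_cast
    field_simp
    ring
end

section
/- For all integers n > s ≥ 2, the quantity g(n, s) := (n − s)/(n(s+1)) − (1 − s/n)^(n+1) − (n·s·(s+1)/(4(n+1)))·((1 − (s−1)/n)^(n+1) − (1 − s/n)^(n+1))² is strictly positive. -/
lemma one_sub_div_pow_le_inv_pow (n k : ℕ) (hk : k ≤ n) :
    (1 - (k : ℝ) / n) ^ n ≤ 1 / (2.7 : ℝ) ^ k := by
  have hexp : (2.7 : ℝ) ≤ Real.exp 1 := by linarith [Real.exp_one_gt_d9]
  calc (1 - (k : ℝ) / n) ^ n ≤ Real.exp (-(k : ℝ)) :=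
        Real.one_sub_div_pow_le_exp_neg (by exact_mod_cast hk)
    _ = 1 / Real.exp 1 ^ k := by rw [Real.exp_neg, ← Real.exp_one_pow, one_div]
    _ ≤ 1 / (2.7 : ℝ) ^ k := by gcongr

lemma four_mul_add_four_le_pow (j : ℕ) : 4 * ((j : ℝ) + 4) ≤ 2.7 ^ (j + 3) := by
  induction j with
  | zero => norm_num
  | succ j ih =>
    rw [show j + 1 + 3 = (j + 3) + 1 by ring, pow_succ]
    push_cast
    nlinarith [(Nat.cast_nonneg j : (0 : ℝ) ≤ j)]

lemma cubic_le_pow (j : ℕ) : ((j : ℝ) + 3) * (j + 4) ^ 2 ≤ (2.7 ^ (j + 2)) ^ 2 := by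
  induction j with
  | zero => norm_num
  | succ j ih =>
    have hj : (0 : ℝ) ≤ j := Nat.cast_nonneg j
    rw [show (2.7 : ℝ) ^ (j + 1 + 2) = 2.7 ^ (j + 2) * 2.7 by ring, mul_pow]
    push_cast
    have : ((j : ℝ) + 1 + 3) * (j + 1 + 4) ^ 2 ≤ (((j : ℝ) + 3) * (j + 4) ^ 2) * 2.7 ^ 2 := by
      nlinarith [pow_nonneg hj 2, pow_nonneg hj 3]
    nlinarith

lemma one_add_inv_pow_le (j : ℕ) (hj : 1 ≤ j) : (1 + 1 / (j : ℝ)) ^ (j + 3) ≤ 25 := by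
  have hj' : (1 : ℝ) ≤ j := by exact_mod_cast hj
  have hpow : (1 + 1 / (j : ℝ)) ^ j ≤ 2.72 := by
    calc (1 + 1 / (j : ℝ)) ^ j ≤ Real.exp (1 / (j : ℝ)) ^ j := by
          gcongr
          linarith [Real.add_one_le_exp (1 / (j : ℝ))]
      _ = Real.exp 1 := by rw [← Real.exp_nat_mul]; congr 1; field_simp
      _ ≤ 2.72 := by linarith [Real.exp_one_lt_d9]
  have hcube : (1 + 1 / (j : ℝ)) ^ 3 ≤ 2 ^ 3 := by
    gcongr
    have : 1 / (j : ℝ) ≤ 1 := by rw [div_le_one (by linarith)]; exact hj'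
    linarith
  rw [pow_add]
  calc (1 + 1 / (j : ℝ)) ^ j * (1 + 1 / (j : ℝ)) ^ 3 ≤ 2.72 * 2 ^ 3 := by gcongr
    _ ≤ 25 := by norm_num

lemma g_pos_two (n : ℕ) (hn : 2 < n) :
    0 < ((n : ℝ) - 2) / (n * (2 + 1)) - (1 - (2 : ℝ) / n) ^ (n + 1)
      - (n : ℝ) * 2 * (2 + 1) / (4 * ((n : ℝ) + 1))
        * ((1 - ((2 : ℝ) - 1) / n) ^ (n + 1) - (1 - (2 : ℝ) / n) ^ (n + 1)) ^ 2 := by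
  have hn' : (3 : ℝ) ≤ n := by exact_mod_cast hn
  have hn0 : (n : ℝ) ≠ 0 := by linarith
  have hp2 := one_sub_div_pow_le_inv_pow n 2 hn.le
  have ht1 := one_sub_div_pow_le_inv_pow n 1 (by omega)
  have hmain : ((n : ℝ) - 2) / (n * (2 + 1)) = (1 - (2 : ℝ) / n) / 3 := by field_simp; ring
  have hratio : (1 - (1 : ℝ) / n) ^ (n + 1) ≤ 25 * (1 - (2 : ℝ) / n) ^ (n + 1) := by
    obtain ⟨j, rfl⟩ : ∃ j, n = j + 2 := ⟨n - 2, by omega⟩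
    have hj' : (1 : ℝ) ≤ j := by push_cast at hn'; linarith
    have hfac : 1 - (1 : ℝ) / ((j + 2 : ℕ) : ℝ)
        = (1 + 1 / (j : ℝ)) * (1 - (2 : ℝ) / ((j + 2 : ℕ) : ℝ)) := by
      push_cast
      field_simp
      ring
    have hp : 0 ≤ 1 - (2 : ℝ) / ((j + 2 : ℕ) : ℝ) := by
      rw [sub_nonneg, div_le_one (by linarith)]; linarith
    rw [hfac, mul_pow]
    have := one_add_inv_pow_le j (by exact_mod_cast hj')
    gcongr
  have hcoef : (n : ℝ) * 2 * (2 + 1) / (4 * ((n : ℝ) + 1)) * (1 - (1 : ℝ) / n) ^ 2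
      ≤ 1.5 * (1 - (2 : ℝ) / n) := by
    rw [← sub_nonneg]
    have : 1.5 * (1 - (2 : ℝ) / n)
        - (n : ℝ) * 2 * (2 + 1) / (4 * ((n : ℝ) + 1)) * (1 - (1 : ℝ) / n) ^ 2
        = 1.5 * ((n : ℝ) - 3) / (n * (n + 1)) := by field_simp; ring
    rw [this]
    exact div_nonneg (by linarith) (by positivity)
  rw [hmain, show (2 : ℝ) - 1 = 1 by norm_num]
  norm_num only [Nat.cast_ofNat, Nat.cast_one] at hp2 ht1
  have hp : 0 < 1 - (2 : ℝ) / n := by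
    rw [sub_pos, div_lt_one (by linarith)]; linarith
  have hpt : 1 - (2 : ℝ) / n ≤ 1 - 1 / n := by gcongr; norm_num
  set p : ℝ := 1 - 2 / n
  set t : ℝ := 1 - 1 / n
  set C : ℝ := (n : ℝ) * 2 * (2 + 1) / (4 * ((n : ℝ) + 1))
  have hC : 0 ≤ C := by positivity
  have ht : 0 ≤ t := hp.le.trans hpt
  have hdiff : (t ^ (n + 1) - p ^ (n + 1)) ^ 2 ≤ (24 / 25 * t ^ (n + 1)) ^ 2 := by
    have : p ^ (n + 1) ≤ t ^ (n + 1) := by gcongr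
    apply pow_le_pow_left₀ <;> linarith
  have htn : (t ^ n) ^ 2 ≤ (10 / 27) ^ 2 := by gcongr
  have hsecond : C * (t ^ (n + 1) - p ^ (n + 1)) ^ 2
      ≤ (1.5 * p) * ((24 / 25) ^ 2 * (10 / 27) ^ 2) := by
    calc C * (t ^ (n + 1) - p ^ (n + 1)) ^ 2 ≤ C * (24 / 25 * t ^ (n + 1)) ^ 2 := by gcongr
      _ = (C * t ^ 2) * ((24 / 25) ^ 2 * (t ^ n) ^ 2) := by ring
      _ ≤ _ := by gcongr
  have hfirst : p ^ (n + 1) ≤ (10 / 27) ^ 2 * p := by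
    rw [pow_succ]; gcongr; linarith
  linarith

lemma g_pos_of_three_le (n s : ℕ) (hs : 3 ≤ s) (hsn : s < n) :
    0 < ((n : ℝ) - s) / (n * (s + 1)) - (1 - (s : ℝ) / n) ^ (n + 1)
      - (n : ℝ) * s * (s + 1) / (4 * ((n : ℝ) + 1))
        * ((1 - ((s : ℝ) - 1) / n) ^ (n + 1) - (1 - (s : ℝ) / n) ^ (n + 1)) ^ 2 := by
  have hsn' : (s : ℝ) + 1 ≤ n := by exact_mod_cast hsn
  have hs' : (3 : ℝ) ≤ s := by exact_mod_cast hs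
  have hn : (0 : ℝ) < n := by linarith
  have hps := one_sub_div_pow_le_inv_pow n s hsn.le
  have hts := one_sub_div_pow_le_inv_pow n (s - 1) (by omega)
  rw [Nat.cast_sub (by omega), Nat.cast_one] at hts
  have hmain : ((n : ℝ) - s) / (n * (s + 1)) = (1 - (s : ℝ) / n) / (s + 1) := by
    field_simp
  have hp : 0 < 1 - (s : ℝ) / n := by
    rw [sub_pos, div_lt_one hn]; linarith
  have hpt : 1 - (s : ℝ) / n ≤ 1 - ((s : ℝ) - 1) / n := by gcongr; linarith
  have htp : 1 - ((s : ℝ) - 1) / n ≤ 2 * (1 - (s : ℝ) / n) := by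
    rw [← sub_nonneg]
    have : 2 * (1 - (s : ℝ) / n) - (1 - ((s : ℝ) - 1) / n) = (n - s - 1) / n := by
      field_simp; ring
    rw [this]
    exact div_nonneg (by linarith) hn.le
  have ht1 : 1 - ((s : ℝ) - 1) / n ≤ 1 := by
    have : 0 ≤ ((s : ℝ) - 1) / n := div_nonneg (by linarith) hn.le
    linarith
  have hcoef : (n : ℝ) * s * (s + 1) / (4 * ((n : ℝ) + 1)) ≤ s * (s + 1) / 4 := by
    rw [div_le_div_iff₀ (by positivity) (by norm_num)]
    nlinarith [show (0 : ℝ) ≤ s * (s + 1) by positivity]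
  rw [hmain]
  set p : ℝ := 1 - s / n
  set t : ℝ := 1 - ((s : ℝ) - 1) / n
  set C : ℝ := (n : ℝ) * s * (s + 1) / (4 * ((n : ℝ) + 1))
  have hC : 0 ≤ C := by positivity
  have ht : 0 ≤ t := hp.le.trans hpt
  have hdecay : 1 / (2.7 : ℝ) ^ s ≤ 1 / (4 * (s + 1)) := by
    apply one_div_le_one_div_of_le (by positivity)
    obtain ⟨j, rfl⟩ : ∃ j, s = j + 3 := ⟨s - 3, by omega⟩
    have := four_mul_add_four_le_pow j
    push_cast
    linarith
  have hdecay_sq : (1 / (2.7 : ℝ) ^ (s - 1)) ^ 2 ≤ 1 / (s * (s + 1) ^ 2) := by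
    rw [div_pow, one_pow]
    apply one_div_le_one_div_of_le (by positivity)
    obtain ⟨j, rfl⟩ : ∃ j, s = j + 3 := ⟨s - 3, by omega⟩
    have := cubic_le_pow j
    rw [show j + 3 - 1 = j + 2 by omega]
    push_cast
    linarith
  have hfirst : p ^ (n + 1) ≤ 1 / (4 * (s + 1)) * p := by
    rw [pow_succ]; gcongr; exact hps.trans hdecay
  have hdiff : (t ^ (n + 1) - p ^ (n + 1)) ^ 2 ≤ (t ^ (n + 1)) ^ 2 := by
    have h1 : p ^ (n + 1) ≤ t ^ (n + 1) := by gcongr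
    have h2 : 0 ≤ p ^ (n + 1) := by positivity
    apply pow_le_pow_left₀ <;> linarith
  have htsq : t ^ 2 ≤ 2 * p := by nlinarith
  have hsecond : C * (t ^ (n + 1) - p ^ (n + 1)) ^ 2 ≤ p / (2 * (s + 1)) := by
    calc C * (t ^ (n + 1) - p ^ (n + 1)) ^ 2
        ≤ (s * (s + 1) / 4) * (t ^ (n + 1)) ^ 2 := by gcongr
      _ = (s * (s + 1) / 4) * ((t ^ n) ^ 2 * t ^ 2) := by ring
      _ ≤ (s * (s + 1) / 4) * ((1 / (2.7 : ℝ) ^ (s - 1)) ^ 2 * (2 * p)) := by gcongr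
      _ ≤ (s * (s + 1) / 4) * (1 / (s * (s + 1) ^ 2) * (2 * p)) := by gcongr
      _ = p / (2 * (s + 1)) := by field_simp; ring
  have htotal : p / (s + 1) - 1 / (4 * (s + 1)) * p - p / (2 * (s + 1))
      = p / (4 * (s + 1)) := by field_simp; ring
  have : 0 < p / (4 * ((s : ℝ) + 1)) := by positivity
  linarith

/-- For all integers `n > s ≥ 2`, the quantity
`g(n, s) = (n − s)/(n(s+1)) − (1 − s/n)^(n+1)
  − (n·s·(s+1)/(4(n+1)))·((1 − (s−1)/n)^(n+1) − (1 − s/n)^(n+1))²`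
is strictly positive. -/
theorem g_pos (n s : ℕ) (hs : 2 ≤ s) (hsn : s < n) :
    0 < ((n : ℝ) - s) / (n * (s + 1)) - (1 - (s : ℝ) / n) ^ (n + 1)
      - (n : ℝ) * s * (s + 1) / (4 * ((n : ℝ) + 1))
        * ((1 - ((s : ℝ) - 1) / n) ^ (n + 1) - (1 - (s : ℝ) / n) ^ (n + 1)) ^ 2 := by
  rcases hs.eq_or_lt with rfl | hs
  · exact_mod_cast g_pos_two n hsn
  · exact g_pos_of_three_le n s hs hsn
end

section
/- For every integer n ≥ 3 and every real x with 0 < x ≤ n, one has ((1 + x)/x)·(1 − (1 − x/n)^n) < 3/2. -/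
theorem one_sub_div_three_pow_le (n : ℕ) (hn : 3 ≤ n) (x : ℝ) (hx : x ≤ 3) :
    (1 - x / 3) ^ 3 ≤ (1 - x / n) ^ n := by
  have hn' : (3 : ℝ) ≤ n := by exact_mod_cast hn
  have hn0 : (0 : ℝ) < n := by linarith
  have hle : x / n ≤ 1 := by rw [div_le_one hn0]; linarith
  have h := one_add_mul_self_le_rpow_one_add (s := -(x / n)) (by linarith) (p := (n : ℝ) / 3)
    (by linarith)
  have e : 1 + (n : ℝ) / 3 * -(x / n) = 1 - x / 3 := by field_simp; ring
  rw [e, ← sub_eq_add_neg] at h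
  calc (1 - x / 3) ^ 3 ≤ ((1 - x / n) ^ ((n : ℝ) / 3)) ^ 3 :=
        pow_le_pow_left₀ (by linarith) h 3
    _ = (1 - x / n) ^ n := by
        rw [← Real.rpow_mul_natCast (by linarith), ← Real.rpow_natCast]
        congr 1
        push_cast
        ring

/-- For every integer `n ≥ 3` and real `0 < x ≤ n`,
`((1 + x)/x)·(1 − (1 − x/n)^n) < 3/2`. -/
theorem l_lt_three_halves (n : ℕ) (hn : 3 ≤ n) (x : ℝ) (hx0 : 0 < x) (hxn : x ≤ n) :
    (1 + x) / x * (1 - (1 - x / n) ^ n) < 3 / 2 := by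
  rw [div_mul_eq_mul_div, div_lt_iff₀ hx0]
  rcases le_or_gt x 2 with hx | hx
  · have h := mul_le_mul_of_nonneg_left (one_sub_div_three_pow_le n hn x (by linarith))
      (by linarith : 0 ≤ 1 + x)
    have hq : 0 < 27 - 36 * x + 16 * x ^ 2 - 2 * x ^ 3 := by
      nlinarith [mul_nonneg (sub_nonneg.2 hx) (sq_nonneg (x - 8 / 5)),
        sq_nonneg (x - 113 / 70)]
    nlinarith [mul_pos hx0 hq]
  · have hn0 : (0 : ℝ) < n := by linarith
    have h : 0 ≤ (1 - x / n) ^ n :=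
      pow_nonneg (sub_nonneg.2 ((div_le_one hn0).2 hxn)) n
    nlinarith [mul_nonneg (by linarith : 0 ≤ 1 + x) h]
end

section
/- For every real z ∈ (0, 3], one has ((1 + z)/z)·(1 − (1 − z/3)³) = (z³ − 8z² + 18z + 27)/27, this quantity is at most (1001 + 20√10)/729 with the maximum attained at z = (8 − √10)/3, and (1001 + 20√10)/729 < 3/2. -/
/-- For every `z ∈ (0, 3]`, one has
`((1 + z)/z)·(1 − (1 − z/3)³) = (z³ − 8z² + 18z + 27)/27`; this quantity is at most
`(1001 + 20√10)/729`, with the maximum attained at `z = (8 − √10)/3`, and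
`(1001 + 20√10)/729 < 3/2`. -/
theorem cubic_max :
    (∀ z : ℝ, 0 < z → z ≤ 3 →
      (1 + z) / z * (1 - (1 - z / 3) ^ 3) = (z ^ 3 - 8 * z ^ 2 + 18 * z + 27) / 27 ∧
      (1 + z) / z * (1 - (1 - z / 3) ^ 3) ≤ (1001 + 20 * Real.sqrt 10) / 729) ∧
    (1 + (8 - Real.sqrt 10) / 3) / ((8 - Real.sqrt 10) / 3)
        * (1 - (1 - (8 - Real.sqrt 10) / 3 / 3) ^ 3) = (1001 + 20 * Real.sqrt 10) / 729 ∧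
    (1001 + 20 * Real.sqrt 10) / 729 < 3 / 2 := by
  have hs : Real.sqrt 10 ^ 2 = 10 := Real.sq_sqrt (by norm_num)
  have hs_lower : 3 < Real.sqrt 10 := Real.lt_sqrt_of_sq_lt (by norm_num)
  have hs_upper : Real.sqrt 10 < 4 := (Real.sqrt_lt' (by norm_num)).2 (by norm_num)
  have cubic_eq : ∀ z : ℝ, 0 < z →
      (1 + z) / z * (1 - (1 - z / 3) ^ 3) = (z ^ 3 - 8 * z ^ 2 + 18 * z + 27) / 27 := by
    intro z hz
    field_simp
    ring
  generalize Real.sqrt 10 = s at *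
  refine ⟨fun z hz hz3 => ⟨cubic_eq z hz, ?_⟩, ?_, by linarith⟩
  · rw [cubic_eq z hz]
    have h : 0 ≤ (z - (8 - s) / 3) ^ 2 * ((8 + 2 * s) / 3 - z) :=
      mul_nonneg (sq_nonneg _) (by linarith)
    linear_combination h / 27 + (2 * s / 729 - 8 / 243 + z / 81) * hs
  · rw [cubic_eq _ (by linarith)]
    linear_combination (-s / 729) * hs
end
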